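/- If θ > 1/2, then setting α = (1−θ)/(2θ−1) > 0, there exist constants A' > 0, B ∈ ℝ and T ≥ 0, with t + B > 0 for all t > T, such that |Q(x(t)) − Q*| ≤ A'·(t + B)^{−α·β} for all t > T, where Q* = Q(z). -/

import Mathlib

open Set Metric Filter

/-- A nonnegative function with `g' ≤ -k g ^ (p + 1)` decays at least like
`t ↦ (p k t) ^ (-1 / p)`. -/
theorem le_rpow_of_hasDerivAt_le_neg_mul_rpow {g g' : ℝ → ℝ} {k p : ℝ} (hk : 0 < k) (hp : 0 < p)
    (hg : ∀ t ≥ 0, HasDerivAt g (g' t) t) (hg0 : ∀ t ≥ 0, 0 ≤ g t)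
    (hle : ∀ t ≥ 0, g' t ≤ -(k * g t ^ (p + 1))) {t : ℝ} (ht : 0 < t) :
    g t ≤ (p * k * t) ^ (-(1 / p)) := by
  rcases (hg0 t ht.le).eq_or_lt with h0 | hpos
  · rw [← h0]
    positivity
  have hanti : AntitoneOn g (Ici 0) := by
    refine antitoneOn_of_deriv_nonpos (convex_Ici 0)
      (fun s hs => (hg s hs).continuousAt.continuousWithinAt) ?_ ?_ <;>
      rw [interior_Ici] <;> intro s hs
    · exact (hg s (mem_Ioi.1 hs).le).differentiableAt.differentiableWithinAt
    · have hs' : s ≥ 0 := (mem_Ioi.1 hs).le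
      rw [(hg s hs').deriv]
      have := mul_nonneg hk.le (Real.rpow_nonneg (hg0 s hs') (p + 1))
      linarith [hle s hs']
  have hgpos : ∀ s ∈ Icc 0 t, 0 < g s := fun s hs =>
    hpos.trans_le (hanti (mem_Ici.2 hs.1) (mem_Ici.2 ht.le) hs.2)
  have hder : ∀ s ∈ Icc 0 t,
      HasDerivAt (fun s => g s ^ (-p)) (g' s * (-p) * g s ^ (-p - 1)) s := fun s hs =>
    (hg s hs.1).rpow_const (Or.inl (hgpos s hs).ne')
  have hgrow := (convex_Icc 0 t).mul_sub_le_image_sub_of_le_deriv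
    (f := fun s => g s ^ (-p)) (C := p * k)
    (fun s hs => (hder s hs).continuousAt.continuousWithinAt)
    (fun s hs => (hder s (interior_subset hs)).differentiableAt.differentiableWithinAt)
    (fun s hs => by
      have hs := interior_subset hs
      rw [(hder s hs).deriv]
      have hone : g s ^ (p + 1) * g s ^ (-p - 1) = 1 := by
        rw [← Real.rpow_add (hgpos s hs)]
        simp
      have hb := mul_le_mul_of_nonneg_right (hle s hs.1)
        (mul_nonneg hp.le (Real.rpow_nonneg (hgpos s hs).le (-p - 1)))
      linear_combination hb - p * k * hone)
    0 (left_mem_Icc.2 ht.le) t (right_mem_Icc.2 ht.le) ht.le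
  have h0 := Real.rpow_nonneg (hg0 0 le_rfl) (-p)
  have hmain : p * k * t ≤ g t ^ (-p) := by
    simp only [sub_zero] at hgrow
    linarith
  calc g t = (g t ^ (-p)) ^ (-(1 / p)) := by
        rw [← Real.rpow_mul hpos.le, neg_mul_neg, mul_one_div_cancel hp.ne', Real.rpow_one]
    _ ≤ (p * k * t) ^ (-(1 / p)) :=
        Real.rpow_le_rpow_of_nonpos (by positivity) hmain (by simp [hp.le])

/-- Along a gradient flow the function has derivative `-‖∇f‖ ^ 2`. -/
theorem HasDerivAt.comp_gradient_flow {E : Type*} [NormedAddCommGroup E] [InnerProductSpace ℝ E]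
    [CompleteSpace E] {f : E → ℝ} {x : ℝ → E} {t : ℝ} (hf : DifferentiableAt ℝ f (x t))
    (hx : HasDerivAt x (-(gradient f (x t))) t) :
    HasDerivAt (fun s => f (x s)) (-‖gradient f (x t)‖ ^ 2) t := by
  have h := hf.hasGradientAt.hasFDerivAt.comp_hasDerivAt t hx
  rwa [map_neg, InnerProductSpace.toDual_apply_apply, real_inner_self_eq_norm_sq] at h

/-- If the Łojasiewicz inequalities hold with exponent `θ > 1/2` on a neighbourhood `V`
of `x*` and `Q` is `β`-Hölder continuous on `U`, then along a gradient flow `x(t)`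
remaining in `V` and converging to a point `z ∈ Z` (with eventually
`‖x(t) − z‖ = d(x(t), Z)`) one has, with `α = (1−θ)/(2θ−1) > 0`, `|Q(x(t)) − Q*| ≤ A'·(t + B)^{−α·β}` for
all `t > T`, where `Q* = Q(z)`, for some constants `A' > 0`, `B ∈ ℝ` and `T ≥ 0`
with `t + B > 0` for all `t > T`. -/
theorem holder_measurement_power_law_convergence {d : ℕ}
    (U : Set (EuclideanSpace ℝ (Fin d))) (hU : IsOpen U)
    (f : EuclideanSpace ℝ (Fin d) → ℝ) (hf : ContDiffOn ℝ 1 f U)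
    (xstar : EuclideanSpace ℝ (Fin d)) (hxstar : xstar ∈ U)
    (hmin : ∀ x ∈ U, f xstar ≤ f x)
    (θ C C' : ℝ) (hθ : θ ∈ Set.Ico (1 / 2 : ℝ) 1) (hC : 0 < C) (hC' : 0 < C')
    (V : Set (EuclideanSpace ℝ (Fin d))) (hV : IsOpen V) (hxV : xstar ∈ V) (hVU : V ⊆ U)
    (hloj₁ : ∀ x ∈ V, C * |f x - f xstar| ^ θ ≤ ‖gradient f x‖)
    (hloj₂ : ∀ x ∈ V,
      C' * (infDist x {y ∈ U | f y = f xstar}) ^ (1 / (1 - θ)) ≤ |f x - f xstar|)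
    (x : ℝ → EuclideanSpace ℝ (Fin d))
    (hflow : ∀ t ≥ (0 : ℝ), HasDerivAt x (-(gradient f (x t))) t)
    (hxinV : ∀ t ≥ (0 : ℝ), x t ∈ V)
    (β : ℝ) (hβ : β ∈ Set.Ioc (0 : ℝ) 1)
    (Q : EuclideanSpace ℝ (Fin d) → ℝ) (K : ℝ) (hK : 0 < K)
    (hQ : ∀ y ∈ U, ∀ y' ∈ U, |Q y - Q y'| ≤ K * ‖y - y'‖ ^ β)
    (z : EuclideanSpace ℝ (Fin d)) (hz : z ∈ {y ∈ U | f y = f xstar})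
    (hconv : Tendsto x atTop (nhds z))
    (T₀ : ℝ) (hT₀ : 0 ≤ T₀)
    (hdist : ∀ t > T₀, ‖x t - z‖ = infDist (x t) {y ∈ U | f y = f xstar})
    (hθgt : 1 / 2 < θ) :
    0 < (1 - θ) / (2 * θ - 1) ∧
    ∃ A' > (0 : ℝ), ∃ B : ℝ, ∃ T ≥ (0 : ℝ), (∀ t > T, 0 < t + B) ∧ ∀ t > T,
      |Q (x t) - Q z| ≤ A' * (t + B) ^ (-((1 - θ) / (2 * θ - 1) * β)) := by
  obtain ⟨-, hθ1⟩ := hθ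
  have hp : 0 < 2 * θ - 1 := by linarith
  have hq : 0 < 1 - θ := by linarith
  have hgap : ∀ t ≥ 0, 0 ≤ f (x t) - f xstar := fun t ht =>
    sub_nonneg.2 (hmin _ (hVU (hxinV t ht)))
  have hdecay : ∀ t > 0, f (x t) - f xstar
      ≤ ((2 * θ - 1) * C ^ 2 * t) ^ (-(1 / (2 * θ - 1))) := fun t ht => by
    refine le_rpow_of_hasDerivAt_le_neg_mul_rpow (g := fun t => f (x t) - f xstar)
      (pow_pos hC 2) hp (fun s hs => (HasDerivAt.comp_gradient_flow
        ((hf.differentiableOn one_ne_zero).differentiableAt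
          (hU.mem_nhds (hVU (hxinV s hs)))) (hflow s hs)).sub_const _)
      hgap (fun s hs => ?_) ht
    have h := hloj₁ _ (hxinV s hs)
    rw [abs_of_nonneg (hgap s hs)] at h
    have hsq := pow_le_pow_left₀ (mul_nonneg hC.le (Real.rpow_nonneg (hgap s hs) θ)) h 2
    rw [mul_pow, ← Real.rpow_mul_natCast (hgap s hs)] at hsq
    rw [show 2 * θ - 1 + 1 = θ * (2 : ℕ) by push_cast; ring]
    exact neg_le_neg hsq
  set c := (2 * θ - 1) * C ^ 2
  have hcpos : 0 < c := by positivity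
  refine ⟨div_pos hq hp, K * (c ^ (-(1 / (2 * θ - 1))) / C') ^ ((1 - θ) * β), by positivity,
    0, T₀, hT₀, fun t ht => by linarith, fun t ht => ?_⟩
  have htpos : 0 < t := hT₀.trans_lt ht
  have hV' := hxinV t htpos.le
  have hdistle : ‖x t - z‖
      ≤ (c ^ (-(1 / (2 * θ - 1))) / C' * t ^ (-(1 / (2 * θ - 1)))) ^ (1 - θ) := by
    have h := hloj₂ _ hV'
    rw [← hdist t ht, abs_of_nonneg (hgap t htpos.le)] at h
    have h' := h.trans (hdecay t htpos)
    rw [Real.mul_rpow hcpos.le htpos.le] at h'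
    have h'' : ‖x t - z‖ ^ (1 / (1 - θ))
        ≤ c ^ (-(1 / (2 * θ - 1))) / C' * t ^ (-(1 / (2 * θ - 1))) := by
      rw [div_mul_eq_mul_div, le_div_iff₀ hC']
      linarith
    calc ‖x t - z‖ = (‖x t - z‖ ^ (1 / (1 - θ))) ^ (1 - θ) := by
          rw [← Real.rpow_mul (norm_nonneg _), one_div_mul_cancel hq.ne', Real.rpow_one]
      _ ≤ _ := Real.rpow_le_rpow (by positivity) h'' hq.le
  calc |Q (x t) - Q z| ≤ K * ‖x t - z‖ ^ β := hQ _ (hVU hV') _ hz.1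
    _ ≤ K * ((c ^ (-(1 / (2 * θ - 1))) / C' * t ^ (-(1 / (2 * θ - 1)))) ^ (1 - θ)) ^ β := by
        gcongr
        exact hβ.1.le
    _ = _ := by
        rw [← Real.rpow_mul (by positivity), Real.mul_rpow (by positivity) (by positivity),
          ← Real.rpow_mul htpos.le, add_zero, mul_assoc]
        congr 3
        ring
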